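/- (Stationary solutions solve the QP surrogate with correctly chosen weights.) Suppose Assumption 1 holds and K = W (no mean-variance constraints). Then w* ∈ W is a stationary solution of (P), i.e., (z − w*)ᵀ∇f(w*) ≥ 0 for all z ∈ W, if and only if w* is a global minimizer over W of the QP surrogate problem with weights λ_x = −∇_x F(x(w*), y(w*)), λ_y = ∇_y F(x(w*), y(w*)) and η = 0, i.e., of the convex problem minimize_{w∈W} −λ_xᵀ x(w) + λ_yᵀ y(w). -/

import Mathlib

/- STATEMENT 9: With K = W and Assumption 1, w* ∈ W is a stationary solution of (P)
iff w* is a global minimizer over W of the QP surrogate problem with weights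
λ_x = −∇_xF(x(w*),y(w*)), λ_y = ∇_yF(x(w*),y(w*)) and η = 0. -/

noncomputable section
open Matrix

def simplex (N : ℕ) : Set (Fin N → ℝ) := {w | (∀ i, 0 ≤ w i) ∧ ∑ i, w i = 1}

def xf {N p : ℕ} (μ : Fin p → Fin N → ℝ) (w : Fin N → ℝ) (i : Fin p) : ℝ := w ⬝ᵥ μ i

def yf {N q : ℕ} (S : Fin q → Matrix (Fin N) (Fin N) ℝ) (w : Fin N → ℝ) (j : Fin q) : ℝ :=
  w ⬝ᵥ (S j).mulVec w

/-- Gradient of `f(w) = F(x(w), y(w))` by the chain rule. -/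
def gradf {N p q : ℕ} (μ : Fin p → Fin N → ℝ) (S : Fin q → Matrix (Fin N) (Fin N) ℝ)
    (Fx : (Fin p → ℝ) → (Fin q → ℝ) → Fin p → ℝ)
    (Fy : (Fin p → ℝ) → (Fin q → ℝ) → Fin q → ℝ)
    (w : Fin N → ℝ) : Fin N → ℝ :=
  fun n => ∑ i, Fx (xf μ w) (yf S w) i * μ i n
    + ∑ j, 2 * Fy (xf μ w) (yf S w) j * (S j).mulVec w n

theorem dotProduct_gradf {N p q : ℕ} (μ : Fin p → Fin N → ℝ)
    (S : Fin q → Matrix (Fin N) (Fin N) ℝ)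
    (Fx : (Fin p → ℝ) → (Fin q → ℝ) → Fin p → ℝ)
    (Fy : (Fin p → ℝ) → (Fin q → ℝ) → Fin q → ℝ) (w d : Fin N → ℝ) :
    d ⬝ᵥ gradf μ S Fx Fy w = Fx (xf μ w) (yf S w) ⬝ᵥ xf μ d
      + 2 * (Fy (xf μ w) (yf S w) ⬝ᵥ fun j => d ⬝ᵥ (S j).mulVec w) := by
  have h : gradf μ S Fx Fy w = ∑ i, Fx (xf μ w) (yf S w) i • μ i
      + ∑ j, (2 * Fy (xf μ w) (yf S w) j) • (S j).mulVec w := by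
    ext n
    simp [gradf, Finset.sum_apply]
  rw [h, dotProduct_add, dotProduct_sum, dotProduct_sum]
  congr 1
  · simp only [dotProduct_smul, smul_eq_mul]
    rfl
  · simp only [dotProduct_smul, smul_eq_mul, mul_assoc, ← Finset.mul_sum]
    rfl

theorem xf_add_smul {N p : ℕ} (μ : Fin p → Fin N → ℝ) (w d : Fin N → ℝ) (t : ℝ) :
    xf μ (w + t • d) = xf μ w + t • xf μ d := by
  ext i
  simp [xf, add_dotProduct, smul_dotProduct]

theorem yf_add_smul {N q : ℕ} {S : Fin q → Matrix (Fin N) (Fin N) ℝ}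
    (hS : ∀ j, (S j).IsSymm) (w d : Fin N → ℝ) (t : ℝ) :
    yf S (w + t • d) =
      yf S w + (2 * t) • (fun j => d ⬝ᵥ (S j).mulVec w) + t ^ 2 • yf S d := by
  ext j
  have hsymm : w ⬝ᵥ (S j).mulVec d = d ⬝ᵥ (S j).mulVec w := by
    rw [dotProduct_mulVec, ← mulVec_transpose, (hS j).eq, dotProduct_comm]
  simp only [yf, mulVec_add, mulVec_smul, add_dotProduct, dotProduct_add, smul_dotProduct,
    dotProduct_smul, smul_eq_mul, Pi.add_apply, Pi.smul_apply, hsymm]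
  ring

theorem convex_simplex (N : ℕ) : Convex ℝ (simplex N) :=
  convex_stdSimplex ℝ (Fin N)

/-- A quadratic `t G + t² Q` with `Q ≥ 0` is nonnegative on `(0, 1]` only if `G ≥ 0`. -/
theorem nonneg_of_forall_quadratic_nonneg {G Q : ℝ} (hQ : 0 ≤ Q)
    (h : ∀ t : ℝ, 0 < t → t ≤ 1 → 0 ≤ t * G + t ^ 2 * Q) : 0 ≤ G := by
  by_contra! hG
  have hpos : 0 < Q - G := by linarith
  have ht : 0 < -G / (Q - G) := div_pos (by linarith) hpos
  have key := h _ ht ((div_le_one hpos).2 (by linarith))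
  have heq : -G / (Q - G) * G + (-G / (Q - G)) ^ 2 * Q = -(-G / (Q - G)) ^ 2 * -G := by
    field_simp
    ring
  rw [heq] at key
  nlinarith [mul_pos (pow_pos ht 2) (neg_pos.2 hG)]

theorem stationary_iff_qp_surrogate_minimizer
    (N p q : ℕ)
    (μ : Fin p → Fin N → ℝ) (S : Fin q → Matrix (Fin N) (Fin N) ℝ)
    (hS : ∀ j, (S j).PosDef)
    (F : (Fin p → ℝ) → (Fin q → ℝ) → ℝ)
    (Fx : (Fin p → ℝ) → (Fin q → ℝ) → Fin p → ℝ)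
    (Fy : (Fin p → ℝ) → (Fin q → ℝ) → Fin q → ℝ)
    (hFsmooth : ContDiff ℝ 1 (fun z : (Fin p → ℝ) × (Fin q → ℝ) => F z.1 z.2))
    (hFderiv : ∀ z : (Fin p → ℝ) × (Fin q → ℝ),
      ∃ L : ((Fin p → ℝ) × (Fin q → ℝ)) →L[ℝ] ℝ,
        (∀ v : (Fin p → ℝ) × (Fin q → ℝ), L v = Fx z.1 z.2 ⬝ᵥ v.1 + Fy z.1 z.2 ⬝ᵥ v.2) ∧
        HasFDerivAt (fun z : (Fin p → ℝ) × (Fin q → ℝ) => F z.1 z.2) L z)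
    -- Assumption 1
    (hA1x : ∀ i, (∃ x y, Fx x y i ≠ 0) → ∀ x y, Fx x y i < 0)
    (hA1y : ∀ j, (∃ x y, Fy x y j ≠ 0) → ∀ x y, 0 < Fy x y j)
    (wstar : Fin N → ℝ) (hwstar : wstar ∈ simplex N) :
    -- stationarity of w* for (P) over K = W
    (∀ z ∈ simplex N, 0 ≤ (z - wstar) ⬝ᵥ gradf μ S Fx Fy wstar) ↔
    -- w* globally minimizes the QP surrogate −λ_xᵀx(w) + λ_yᵀy(w) over W,
    -- where λ_x = −∇_xF(x(w*),y(w*)) and λ_y = ∇_yF(x(w*),y(w*))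
    (∀ w ∈ simplex N,
      -((fun i => -(Fx (xf μ wstar) (yf S wstar) i)) ⬝ᵥ xf μ wstar)
          + Fy (xf μ wstar) (yf S wstar) ⬝ᵥ yf S wstar ≤
        -((fun i => -(Fx (xf μ wstar) (yf S wstar) i)) ⬝ᵥ xf μ w)
          + Fy (xf μ wstar) (yf S wstar) ⬝ᵥ yf S w) := by
  have hsymm : ∀ j, (S j).IsSymm := fun j => by
    simpa [Matrix.IsHermitian, Matrix.IsSymm] using (hS j).isHermitian
  have hFy : ∀ j, 0 ≤ Fy (xf μ wstar) (yf S wstar) j := fun j => by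
    by_cases h : ∃ x y, Fy x y j ≠ 0
    · exact (hA1y j h _ _).le
    · push Not at h
      exact (h _ _).ge
  have hQ : ∀ d, 0 ≤ Fy (xf μ wstar) (yf S wstar) ⬝ᵥ yf S d := fun d =>
    Finset.sum_nonneg fun j _ => mul_nonneg (hFy j) <| by
      simpa [yf] using (hS j).posSemidef.dotProduct_mulVec_nonneg d
  have hneg : ∀ v, -((fun i => -(Fx (xf μ wstar) (yf S wstar) i)) ⬝ᵥ v) =
      Fx (xf μ wstar) (yf S wstar) ⬝ᵥ v := fun v => by
    simp [dotProduct]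
  simp only [hneg]
  have hexp : ∀ d (t : ℝ),
      Fx (xf μ wstar) (yf S wstar) ⬝ᵥ xf μ (wstar + t • d)
        + Fy (xf μ wstar) (yf S wstar) ⬝ᵥ yf S (wstar + t • d) =
      Fx (xf μ wstar) (yf S wstar) ⬝ᵥ xf μ wstar + Fy (xf μ wstar) (yf S wstar) ⬝ᵥ yf S wstar
        + (t * (d ⬝ᵥ gradf μ S Fx Fy wstar)
          + t ^ 2 * (Fy (xf μ wstar) (yf S wstar) ⬝ᵥ yf S d)) := fun d t => by
    rw [xf_add_smul, yf_add_smul hsymm, dotProduct_gradf]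
    simp only [dotProduct_add, dotProduct_smul, smul_eq_mul]
    ring
  constructor
  · intro h w hw
    have hw' := hexp (w - wstar) 1
    rw [one_smul, add_sub_cancel] at hw'
    linarith [h w hw, hQ (w - wstar)]
  · intro h z hz
    refine nonneg_of_forall_quadratic_nonneg (hQ (z - wstar)) fun t ht ht1 => ?_
    have hmem := (convex_simplex N).add_smul_sub_mem hwstar hz ⟨ht.le, ht1⟩
    linarith [h _ hmem, hexp (z - wstar) t]
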